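/- Let f : [m,M] → ℝ be a convex function with f(t) > 0 for all t ∈ [m,M], let x₁,…,xₙ, y₁,…,yₙ ∈ [m,M], and let p₁,…,pₙ be positive real numbers with ∑_{i=1}^n pᵢ = 1. Suppose ∑_{i=1}^n pᵢ xᵢ = ∑_{i=1}^n pᵢ yᵢ. Then for any real K such that (a_f t + b_f)/f(t) ≤ K for all t ∈ [m,M], one has ∑_{i=1}^n pᵢ f(yᵢ) ≤ K · ∑_{i=1}^n pᵢ f(xᵢ). -/

import Mathlib

theorem ConvexOn.le_chord {m M : ℝ} (hmM : m < M) {f : ℝ → ℝ}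
    (hconv : ConvexOn ℝ (Set.Icc m M) f) {t : ℝ} (ht : t ∈ Set.Icc m M) :
    f t ≤ ((f M - f m) / (M - m)) * t + (M * f m - m * f M) / (M - m) := by
  have hd : 0 < M - m := sub_pos.mpr hmM
  have hsum : (M - t) / (M - m) + (t - m) / (M - m) = 1 := by
    field_simp
    ring
  have h := hconv.2 (Set.left_mem_Icc.mpr hmM.le) (Set.right_mem_Icc.mpr hmM.le)
    (div_nonneg (sub_nonneg.mpr ht.2) hd.le) (div_nonneg (sub_nonneg.mpr ht.1) hd.le) hsum
  simp only [smul_eq_mul] at h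
  have hpt : (M - t) / (M - m) * m + (t - m) / (M - m) * M = t := by
    field_simp
    ring
  rw [hpt] at h
  refine h.trans_eq ?_
  field_simp
  ring

theorem stmt4 (m M : ℝ) (hmM : m < M) (f : ℝ → ℝ)
    (hconv : ConvexOn ℝ (Set.Icc m M) f)
    (hfpos : ∀ t ∈ Set.Icc m M, 0 < f t)
    (n : ℕ) (x y : Fin n → ℝ)
    (hx : ∀ i, x i ∈ Set.Icc m M) (hy : ∀ i, y i ∈ Set.Icc m M)
    (p : Fin n → ℝ) (hp : ∀ i, 0 < p i) (hp1 : ∑ i, p i = 1)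
    (heq : ∑ i, p i * x i = ∑ i, p i * y i)
    (K : ℝ)
    (hK : ∀ t ∈ Set.Icc m M,
      (((f M - f m) / (M - m)) * t + (M * f m - m * f M) / (M - m)) / f t ≤ K) :
    ∑ i, p i * f (y i) ≤ K * ∑ i, p i * f (x i) := by
  set a := (f M - f m) / (M - m)
  set b := (M * f m - m * f M) / (M - m)
  have haffine (z : Fin n → ℝ) : ∑ i, p i * (a * z i + b) = a * ∑ i, p i * z i + b := by
    calc ∑ i, p i * (a * z i + b) = a * ∑ i, p i * z i + b * ∑ i, p i := by
          rw [Finset.mul_sum, Finset.mul_sum, ← Finset.sum_add_distrib]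
          exact Finset.sum_congr rfl fun i _ => by ring
      _ = a * ∑ i, p i * z i + b := by rw [hp1, mul_one]
  calc ∑ i, p i * f (y i) ≤ ∑ i, p i * (a * y i + b) :=
        Finset.sum_le_sum fun i _ =>
          mul_le_mul_of_nonneg_left (hconv.le_chord hmM (hy i)) (hp i).le
    _ = ∑ i, p i * (a * x i + b) := by rw [haffine, haffine, heq]
    _ ≤ ∑ i, p i * (K * f (x i)) :=
        Finset.sum_le_sum fun i _ => mul_le_mul_of_nonneg_left
          ((div_le_iff₀ (hfpos _ (hx i))).mp (hK _ (hx i))) (hp i).le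
    _ = K * ∑ i, p i * f (x i) := by
        rw [Finset.mul_sum]
        exact Finset.sum_congr rfl fun i _ => by ring
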